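/- Let ε > 0. There is a constant C(ε) > 0 such that for all real X, D ≥ 1 and any complex numbers η_d indexed by integers d ∈ [D, 2D], one has ∑_{n ∈ [X,2X] ∩ ℤ} | ∑_{d ∈ [D,2D] ∩ ℤ, d | n} η_d |^2 ≤ C(ε) · (X·D^{ε−1} + D) · ∑_{d ∈ [D,2D] ∩ ℤ} |η_d|^2. -/

import Mathlib

open Finset

lemma add_one_le_const_mul_rpow {δ : ℝ} (hδ : 0 < δ) {p : ℕ} (hp : 2 ≤ p) (v : ℕ) :
    (v : ℝ) + 1 ≤ (1 + 1 / (δ * Real.log 2)) * ((p : ℝ) ^ v) ^ δ := by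
  have hlog : 0 < Real.log 2 := Real.log_pos one_lt_two
  have hp' : (2 : ℝ) ≤ p := by exact_mod_cast hp
  have hbase : 1 + δ * Real.log 2 * v ≤ ((p : ℝ) ^ v) ^ δ := calc
    1 + δ * Real.log 2 * v ≤ Real.exp (δ * Real.log 2 * v) := by
      linarith [Real.add_one_le_exp (δ * Real.log 2 * v)]
    _ = ((2 : ℝ) ^ v) ^ δ := by
      rw [Real.rpow_def_of_pos (by positivity), Real.log_pow]
      ring_nf
    _ ≤ ((p : ℝ) ^ v) ^ δ := by gcongr
  calc (v : ℝ) + 1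
      ≤ (1 + 1 / (δ * Real.log 2)) * (1 + δ * Real.log 2 * v) := by
        have h : (1 + 1 / (δ * Real.log 2)) * (1 + δ * Real.log 2 * v)
            = v + 1 + (1 / (δ * Real.log 2) + δ * Real.log 2 * v) := by
          field_simp
          ring
        rw [h]
        have : 0 ≤ 1 / (δ * Real.log 2) + δ * Real.log 2 * v := by positivity
        linarith
    _ ≤ _ := by gcongr

lemma add_one_le_rpow_of_two_le_rpow {δ : ℝ} {p : ℕ} (hp : 2 ≤ (p : ℝ) ^ δ) (v : ℕ) :
    (v : ℝ) + 1 ≤ ((p : ℝ) ^ v) ^ δ := by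
  have h : ((p : ℝ) ^ v) ^ δ = ((p : ℝ) ^ δ) ^ v := by
    rw [← Real.rpow_natCast_mul p.cast_nonneg, mul_comm, Real.rpow_mul_natCast p.cast_nonneg]
  rw [h]
  calc (v : ℝ) + 1 ≤ (2 : ℝ) ^ v := by exact_mod_cast Nat.lt_two_pow_self (n := v)
    _ ≤ _ := by gcongr

/-- The divisor bound `τ(n) ≪ n ^ δ`. -/
theorem exists_card_divisors_le_rpow {δ : ℝ} (hδ : 0 < δ) :
    ∃ C : ℝ, 0 < C ∧ ∀ n : ℕ, n ≠ 0 → (#n.divisors : ℝ) ≤ C * (n : ℝ) ^ δ := by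
  set K : ℝ := 1 + 1 / (δ * Real.log 2)
  have hK1 : 1 ≤ K := by
    have : 0 < Real.log 2 := Real.log_pos one_lt_two
    have : 0 ≤ 1 / (δ * Real.log 2) := by positivity
    linarith
  set P : ℕ := ⌈(2 : ℝ) ^ (1 / δ)⌉₊
  refine ⟨K ^ P, by positivity, fun n hn ↦ ?_⟩
  have hlocal : ∀ p ∈ n.primeFactors, ((n.factorization p + 1 : ℕ) : ℝ) ≤
      (if p < P then K else 1) * ((p : ℝ) ^ n.factorization p) ^ δ := by
    intro p hp
    push_cast
    split_ifs with h
    · exact add_one_le_const_mul_rpow hδ (Nat.prime_of_mem_primeFactors hp).two_le _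
    · rw [one_mul]
      refine add_one_le_rpow_of_two_le_rpow ?_ _
      have h2 : (2 : ℝ) ^ (1 / δ) ≤ p := Nat.ceil_le.mp (not_lt.mp h)
      calc (2 : ℝ) = ((2 : ℝ) ^ (1 / δ)) ^ δ := by
            rw [← Real.rpow_mul (by norm_num), one_div_mul_cancel hδ.ne', Real.rpow_one]
        _ ≤ _ := by gcongr
  have hconst : ∏ p ∈ n.primeFactors, (if p < P then K else 1) ≤ K ^ P := by
    rw [← prod_filter, prod_const]
    refine pow_le_pow_right₀ hK1 ?_
    calc #{p ∈ n.primeFactors | p < P} ≤ #(range P) :=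
          card_le_card fun p hp ↦ mem_range.mpr (mem_filter.mp hp).2
      _ = P := card_range P
  have hprod : ∏ p ∈ n.primeFactors, ((p : ℝ) ^ n.factorization p) ^ δ = (n : ℝ) ^ δ := by
    rw [Real.finsetProd_rpow _ _ fun p _ ↦ by positivity]
    congr 1
    exact_mod_cast Nat.prod_factorization_pow_eq_self hn
  calc (#n.divisors : ℝ) = ∏ p ∈ n.primeFactors, ((n.factorization p + 1 : ℕ) : ℝ) := by
        rw [Nat.card_divisors hn, Nat.cast_prod]
    _ ≤ ∏ p ∈ n.primeFactors,
          ((if p < P then K else 1) * ((p : ℝ) ^ n.factorization p) ^ δ) :=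
        prod_le_prod (fun _ _ ↦ by positivity) hlocal
    _ ≤ K ^ P * (n : ℝ) ^ δ := by
        rw [prod_mul_distrib, hprod]
        gcongr

lemma card_Icc_filter_dvd_le {a b : ℝ} (hab : a ≤ b) {r : ℤ} (hr : 0 < r) :
    (#{n ∈ Icc ⌈a⌉ ⌊b⌋ | r ∣ n} : ℝ) ≤ (b - a) / r + 1 := by
  have hr' : (0 : ℝ) < r := by exact_mod_cast hr
  have hcard : #{n ∈ Icc ⌈a⌉ ⌊b⌋ | r ∣ n} ≤ #(Icc ⌈a / r⌉ ⌊b / r⌋) := by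
    refine card_le_card_of_injOn (· / r) ?_ ?_
    · intro n hn
      obtain ⟨hn, k, rfl⟩ := mem_filter.mp hn
      rw [mem_Icc, Int.ceil_le, Int.le_floor] at hn
      push_cast at hn
      simp only [Int.mul_ediv_cancel_left k hr.ne', mem_coe, mem_Icc, Int.ceil_le, Int.le_floor]
      rw [div_le_iff₀ hr', le_div_iff₀ hr']
      constructor <;> linarith [hn.1, hn.2]
    · intro m hm n hn h
      exact (Int.ediv_left_inj (mem_filter.mp hm).2 (mem_filter.mp hn).2).mp h
  calc (#{n ∈ Icc ⌈a⌉ ⌊b⌋ | r ∣ n} : ℝ) ≤ #(Icc ⌈a / r⌉ ⌊b / r⌋) := by exact_mod_cast hcard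
    _ = ((max (⌊b / r⌋ + 1 - ⌈a / r⌉) 0 : ℤ) : ℝ) := by
      rw [Int.card_Icc, ← Int.toNat_eq_max, Int.cast_natCast]
    _ ≤ (b - a) / r + 1 := by
      have : 0 ≤ (b - a) / r := div_nonneg (sub_nonneg.mpr hab) hr'.le
      push_cast
      refine max_le ?_ (by linarith)
      rw [sub_div]
      linarith [Int.floor_le (b / r), Int.le_ceil (a / r)]

lemma sum_gcd_le {D : ℝ} (hD : 1 ≤ D) {d : ℤ} (hd : d ∈ Icc ⌈D⌉ ⌊2 * D⌋) :
    ∑ e ∈ Icc ⌈D⌉ ⌊2 * D⌋, (d.gcd e : ℝ) ≤ 3 * D * #d.natAbs.divisors := by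
  rw [mem_Icc, Int.ceil_le, Int.le_floor] at hd
  have hd0 : 0 < d := by exact_mod_cast (by linarith : (0 : ℝ) < d)
  have hdn : d.natAbs ≠ 0 := Int.natAbs_ne_zero.mpr hd0.ne'
  calc ∑ e ∈ Icc ⌈D⌉ ⌊2 * D⌋, (d.gcd e : ℝ)
      ≤ ∑ e ∈ Icc ⌈D⌉ ⌊2 * D⌋, ∑ g ∈ d.natAbs.divisors,
          if (g : ℤ) ∣ e then (g : ℝ) else 0 := by
        refine sum_le_sum fun e _ ↦ ?_
        have hmem : d.gcd e ∈ d.natAbs.divisors :=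
          Nat.mem_divisors.mpr ⟨Int.natCast_dvd.mp (Int.gcd_dvd_left d e), hdn⟩
        refine le_trans ?_ (single_le_sum (fun g _ ↦ by positivity) hmem)
        rw [if_pos (Int.gcd_dvd_right d e)]
    _ = ∑ g ∈ d.natAbs.divisors, (#{e ∈ Icc ⌈D⌉ ⌊2 * D⌋ | (g : ℤ) ∣ e} : ℝ) * g := by
        rw [sum_comm]
        refine sum_congr rfl fun g _ ↦ ?_
        rw [← sum_filter, sum_const, nsmul_eq_mul]
    _ ≤ ∑ g ∈ d.natAbs.divisors, 3 * D := by
        refine sum_le_sum fun g hg ↦ ?_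
        have hg0 : 0 < g := Nat.pos_of_mem_divisors hg
        have hg0' : (0 : ℝ) < g := by exact_mod_cast hg0
        have hgd : (g : ℝ) ≤ d := by
          exact_mod_cast Int.le_of_dvd hd0 (Int.natCast_dvd.mpr (Nat.dvd_of_mem_divisors hg))
        calc (#{e ∈ Icc ⌈D⌉ ⌊2 * D⌋ | (g : ℤ) ∣ e} : ℝ) * g
            ≤ ((2 * D - D) / (g : ℤ) + 1) * g := by
              gcongr
              exact card_Icc_filter_dvd_le (by linarith) (by exact_mod_cast hg0)
          _ = D + g := by
              push_cast
              field_simp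
              ring
          _ ≤ 3 * D := by linarith [hd.2]
    _ = 3 * D * #d.natAbs.divisors := by rw [sum_const, nsmul_eq_mul, mul_comm]

/-- Schur's test for a symmetric nonnegative kernel. -/
lemma sum_sum_mul_le_of_symm {ι : Type*} (s : Finset ι) (x : ι → ℝ) (w : ι → ι → ℝ)
    (hw : ∀ i j, 0 ≤ w i j) (hsymm : ∀ i j, w i j = w j i) {B : ℝ}
    (hB : ∀ i ∈ s, ∑ j ∈ s, w i j ≤ B) :
    ∑ i ∈ s, ∑ j ∈ s, x i * x j * w i j ≤ B * ∑ i ∈ s, x i ^ 2 := by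
  have hdiag : ∑ i ∈ s, ∑ j ∈ s, x i ^ 2 * w i j ≤ B * ∑ i ∈ s, x i ^ 2 := by
    rw [mul_sum]
    refine sum_le_sum fun i hi ↦ ?_
    rw [← mul_sum, mul_comm]
    exact mul_le_mul_of_nonneg_right (hB i hi) (sq_nonneg _)
  have hswap : ∑ i ∈ s, ∑ j ∈ s, x j ^ 2 * w i j = ∑ i ∈ s, ∑ j ∈ s, x i ^ 2 * w i j := by
    rw [sum_comm]
    exact sum_congr rfl fun i _ ↦ sum_congr rfl fun j _ ↦ by rw [hsymm]
  have hamgm : 2 * ∑ i ∈ s, ∑ j ∈ s, x i * x j * w i j ≤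
      ∑ i ∈ s, ∑ j ∈ s, x i ^ 2 * w i j + ∑ i ∈ s, ∑ j ∈ s, x j ^ 2 * w i j := by
    simp only [mul_sum, ← sum_add_distrib]
    refine sum_le_sum fun i _ ↦ sum_le_sum fun j _ ↦ ?_
    nlinarith [mul_nonneg (hw i j) (sq_nonneg (x i - x j))]
  linarith

lemma card_Icc_filter_dvd_and_dvd_le {X D : ℝ} (hX : 0 ≤ X) (hD : 0 < D) {d e : ℤ}
    (hd : D ≤ d) (he : D ≤ e) :
    (#{n ∈ Icc ⌈X⌉ ⌊2 * X⌋ | d ∣ n ∧ e ∣ n} : ℝ) ≤ X / D ^ 2 * d.gcd e + 1 := by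
  have hd0 : 0 < d := by exact_mod_cast hD.trans_le hd
  have he0 : 0 < e := by exact_mod_cast hD.trans_le he
  have hl : 0 < d.lcm e := Int.lcm_pos hd0.ne' he0.ne'
  have hgl : (d.gcd e : ℝ) * d.lcm e = d * e := by
    have h : (d.gcd e : ℤ) * d.lcm e = d * e := by
      rw [← Nat.cast_mul, Int.gcd_mul_lcm, Nat.cast_mul, Int.natAbs_of_nonneg hd0.le,
        Int.natAbs_of_nonneg he0.le]
    exact_mod_cast h
  have hsub : #{n ∈ Icc ⌈X⌉ ⌊2 * X⌋ | d ∣ n ∧ e ∣ n} ≤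
      #{n ∈ Icc ⌈X⌉ ⌊2 * X⌋ | (d.lcm e : ℤ) ∣ n} :=
    card_le_card <| monotone_filter_right _ fun n _ h ↦ Int.coe_lcm_dvd h.1 h.2
  calc (#{n ∈ Icc ⌈X⌉ ⌊2 * X⌋ | d ∣ n ∧ e ∣ n} : ℝ)
      ≤ #{n ∈ Icc ⌈X⌉ ⌊2 * X⌋ | (d.lcm e : ℤ) ∣ n} := by exact_mod_cast hsub
    _ ≤ (2 * X - X) / (d.lcm e : ℤ) + 1 :=
        card_Icc_filter_dvd_le (by linarith) (by exact_mod_cast hl)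
    _ ≤ X / D ^ 2 * d.gcd e + 1 := by
        gcongr
        rw [div_mul_eq_mul_div, div_le_div_iff₀ (by exact_mod_cast hl) (by positivity)]
        push_cast
        have : D ^ 2 ≤ d * e := by
          rw [sq]
          gcongr
        calc (2 * X - X) * D ^ 2 = X * D ^ 2 := by ring
          _ ≤ X * (d * e) := by gcongr
          _ = X * d.gcd e * d.lcm e := by rw [← hgl, mul_assoc]

lemma sum_sq_sum_filter_dvd (N S : Finset ℤ) (x : ℤ → ℝ) :
    ∑ n ∈ N, (∑ d ∈ S with d ∣ n, x d) ^ 2 =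
      ∑ d ∈ S, ∑ e ∈ S, x d * x e * #{n ∈ N | d ∣ n ∧ e ∣ n} := by
  simp only [sum_filter, sq, sum_mul_sum]
  rw [sum_comm]
  refine sum_congr rfl fun d _ ↦ ?_
  rw [sum_comm]
  refine sum_congr rfl fun e _ ↦ ?_
  simp only [ite_zero_mul_ite_zero]
  rw [← sum_filter, sum_const, nsmul_eq_mul, mul_comm]

theorem large_sieve_type_inequality_dual_form (ε : ℝ) (hε : 0 < ε) :
    ∃ C : ℝ, 0 < C ∧
      ∀ (X D : ℝ), 1 ≤ X → 1 ≤ D → ∀ η : ℤ → ℂ,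
        ∑ n ∈ Finset.Icc ⌈X⌉ ⌊2 * X⌋,
            ‖∑ d ∈ (Finset.Icc ⌈D⌉ ⌊2 * D⌋).filter (fun d => d ∣ n), η d‖ ^ 2 ≤
          C * (X * D ^ (ε - 1) + D) * ∑ d ∈ Finset.Icc ⌈D⌉ ⌊2 * D⌋, ‖η d‖ ^ 2 := by
  obtain ⟨C, hC, hdiv⟩ := exists_card_divisors_le_rpow hε
  refine ⟨3 * C * 2 ^ ε + 2, by positivity, fun X D hX hD η ↦ ?_⟩
  have hX0 : 0 < X := by linarith
  have hD0 : 0 < D := by linarith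
  set S := Icc ⌈D⌉ ⌊2 * D⌋ with hS
  have hcard : (#S : ℝ) ≤ 2 * D := by
    have h := card_Icc_filter_dvd_le (by linarith : D ≤ 2 * D) one_pos
    simp only [one_dvd, filter_true, Int.cast_one, div_one] at h
    linarith
  have hmem : ∀ d ∈ S, D ≤ d ∧ d ≤ 2 * D := fun d hd ↦ by
    rwa [hS, mem_Icc, Int.ceil_le, Int.le_floor] at hd
  have hrow : ∀ d ∈ S, ∑ e ∈ S, (X / D ^ 2 * d.gcd e + 1) ≤
      (3 * C * 2 ^ ε + 2) * (X * D ^ (ε - 1) + D) := by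
    intro d hd
    have hd0 : 0 < d := by exact_mod_cast hD0.trans_le (hmem d hd).1
    have habs : (d.natAbs : ℝ) = d := by
      rw [Nat.cast_natAbs, abs_of_pos hd0]
    have hτ : (#d.natAbs.divisors : ℝ) ≤ C * (2 ^ ε * D ^ ε) := by
      refine (hdiv _ (Int.natAbs_ne_zero.mpr hd0.ne')).trans ?_
      rw [← Real.mul_rpow zero_le_two hD0.le, habs]
      have : (0 : ℝ) ≤ d := by exact_mod_cast hd0.le
      gcongr
      exact (hmem d hd).2
    calc ∑ e ∈ S, (X / D ^ 2 * d.gcd e + 1)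
        = X / D ^ 2 * ∑ e ∈ S, (d.gcd e : ℝ) + #S := by
          rw [sum_add_distrib, ← mul_sum, sum_const, nsmul_one]
      _ ≤ X / D ^ 2 * (3 * D * (C * (2 ^ ε * D ^ ε))) + 2 * D := by
          gcongr
          exact (sum_gcd_le hD hd).trans (by gcongr)
      _ = 3 * C * 2 ^ ε * (X * D ^ (ε - 1)) + 2 * D := by
          rw [Real.rpow_sub_one hD0.ne']
          field_simp
      _ ≤ (3 * C * 2 ^ ε + 2) * (X * D ^ (ε - 1) + D) := by
          have h₁ : 0 ≤ 3 * C * 2 ^ ε * D := by positivity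
          have h₂ : 0 ≤ X * D ^ (ε - 1) := by positivity
          linarith
  calc ∑ n ∈ Icc ⌈X⌉ ⌊2 * X⌋, ‖∑ d ∈ S with d ∣ n, η d‖ ^ 2
      ≤ ∑ n ∈ Icc ⌈X⌉ ⌊2 * X⌋, (∑ d ∈ S with d ∣ n, ‖η d‖) ^ 2 := by
        gcongr
        exact norm_sum_le _ _
    _ = ∑ d ∈ S, ∑ e ∈ S, ‖η d‖ * ‖η e‖ * #{n ∈ Icc ⌈X⌉ ⌊2 * X⌋ | d ∣ n ∧ e ∣ n} :=
        sum_sq_sum_filter_dvd _ _ _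
    _ ≤ ∑ d ∈ S, ∑ e ∈ S, ‖η d‖ * ‖η e‖ * (X / D ^ 2 * d.gcd e + 1) := by
        gcongr with d hd e he
        exact card_Icc_filter_dvd_and_dvd_le hX0.le hD0 (hmem d hd).1 (hmem e he).1
    _ ≤ _ := sum_sum_mul_le_of_symm S _ _ (fun d e ↦ by positivity)
        (fun d e ↦ by rw [Int.gcd_comm]) hrow
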